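/- arXiv:1412.4973 — 3 statements merged into one kernel-verified Lean document; each statement's English description precedes it below -/
import Mathlib

section
/- Let Q be a square real matrix with nonnegative entries whose row sums are all at most 1, and suppose that for every index i there exists an integer r ≥ 1 such that the i-th row sum of Q^r is strictly less than 1. Then Q^r converges to the zero matrix as r → ∞ (entrywise, equivalently in any matrix norm). -/
namespace Matrix

variable {ι : Type*} [Fintype ι] [DecidableEq ι] {Q : Matrix ι ι ℝ}

theorem pow_apply_nonneg_of_nonneg (hnn : ∀ i j, 0 ≤ Q i j) (r : ℕ) (i j : ι) :
    0 ≤ (Q ^ r) i j := by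
  induction r generalizing i j with
  | zero => rw [pow_zero, one_apply]; split_ifs <;> norm_num
  | succ r ih =>
    rw [pow_succ, mul_apply]
    exact Finset.sum_nonneg fun k _ => mul_nonneg (ih i k) (hnn k j)

/-- If the row sums of `Q ^ b` are at most `c`, multiplying `Q ^ a` by `Q ^ b` scales its row sums
by at most `c`. -/
theorem sum_pow_add_apply_le (hnn : ∀ i j, 0 ≤ Q i j) {b : ℕ} {c : ℝ}
    (hb : ∀ k, ∑ j, (Q ^ b) k j ≤ c) (a : ℕ) (i : ι) :
    ∑ j, (Q ^ (a + b)) i j ≤ (∑ j, (Q ^ a) i j) * c := by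
  simp only [pow_add, mul_apply]
  rw [Finset.sum_comm, Finset.sum_mul]
  refine Finset.sum_le_sum fun k _ => ?_
  rw [← Finset.mul_sum]
  exact mul_le_mul_of_nonneg_left (hb k) (pow_apply_nonneg_of_nonneg hnn a i k)

theorem antitone_sum_pow_apply (hnn : ∀ i j, 0 ≤ Q i j) (hrow : ∀ i, ∑ j, Q i j ≤ 1) (i : ι) :
    Antitone fun r : ℕ => ∑ j, (Q ^ r) i j :=
  antitone_nat_of_succ_le fun r => by
    simpa using sum_pow_add_apply_le (b := 1) (c := 1) hnn (by simpa using hrow) r i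

theorem sum_pow_mul_apply_le (hnn : ∀ i j, 0 ≤ Q i j) {N : ℕ} {c : ℝ} (hc : 0 ≤ c)
    (hN : ∀ k, ∑ j, (Q ^ N) k j ≤ c) (k : ℕ) (i : ι) :
    ∑ j, (Q ^ (N * k)) i j ≤ c ^ k := by
  induction k with
  | zero => simp [one_apply]
  | succ k ih =>
    rw [Nat.mul_succ, pow_succ]
    exact (sum_pow_add_apply_le hnn hN _ i).trans (mul_le_mul_of_nonneg_right ih hc)

end Matrix

open Filter Topology in
/-- If `Q` is entrywise nonnegative with all row sums at most 1, and for every index `i`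
some power `Q^r` (with `r ≥ 1`) has `i`-th row sum strictly less than 1, then
`Q^r → 0` as `r → ∞`. -/
theorem substochastic_powers_tendsto_zero (n : ℕ) (Q : Matrix (Fin n) (Fin n) ℝ)
    (hnn : ∀ i j, 0 ≤ Q i j) (hrow : ∀ i, ∑ j, Q i j ≤ 1)
    (h : ∀ i : Fin n, ∃ r : ℕ, 1 ≤ r ∧ ∑ j, (Q ^ r) i j < 1) :
    Filter.Tendsto (fun r : ℕ => Q ^ r) Filter.atTop (nhds 0) := by
  have hanti := Matrix.antitone_sum_pow_apply hnn hrow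
  obtain ⟨N, hN, hN1⟩ : ∃ N : ℕ, (∀ i, ∑ j, (Q ^ N) i j < 1) ∧ 1 ≤ N := by
    refine ((eventually_all.2 fun i => ?_).and (eventually_ge_atTop 1)).exists
    obtain ⟨r, -, hr⟩ := h i
    exact (eventually_ge_atTop r).mono fun m hm => (hanti i hm).trans_lt hr
  obtain ⟨c, ⟨hcN, hc0⟩, hc1⟩ :
      ∃ c : ℝ, ((∀ i, ∑ j, (Q ^ N) i j < c) ∧ 0 < c) ∧ c < 1 := by
    refine (((eventually_all.2 fun i => ?_).and ?_).and
      (self_mem_nhdsWithin (a := (1 : ℝ)) (s := Set.Iio 1))).exists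
    · exact nhdsWithin_le_nhds (lt_mem_nhds (hN i))
    · exact nhdsWithin_le_nhds (lt_mem_nhds one_pos)
  have hlim : Tendsto (fun r : ℕ => c ^ (r / N)) atTop (𝓝 0) :=
    (tendsto_pow_atTop_nhds_zero_of_lt_one hc0.le hc1).comp
      (Nat.tendsto_div_const_atTop (by lia))
  refine tendsto_pi_nhds.2 fun i => tendsto_pi_nhds.2 fun j => ?_
  refine squeeze_zero (fun r => Matrix.pow_apply_nonneg_of_nonneg hnn r i j) (fun r => ?_) hlim
  calc (Q ^ r) i j ≤ ∑ k, (Q ^ r) i k :=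
        Finset.single_le_sum (fun k _ => Matrix.pow_apply_nonneg_of_nonneg hnn r i k)
          (Finset.mem_univ j)
    _ ≤ ∑ k, (Q ^ (N * (r / N))) i k := hanti i (Nat.mul_div_le r N)
    _ ≤ c ^ (r / N) := Matrix.sum_pow_mul_apply_le hnn hc0.le (fun k => (hcN k).le) _ i
end

section
/- Let Q be a square real matrix with nonnegative entries whose row sums are all at most 1, and suppose that for every index i there exists an integer r ≥ 1 such that the i-th row sum of Q^r is strictly less than 1. Then the matrix I − Q is invertible. -/
/-- Powers of an entrywise nonnegative matrix are entrywise nonnegative. -/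
theorem Matrix.pow_apply_nonneg_of_nonneg_s5 {ι : Type*} [Fintype ι] [DecidableEq ι]
    {Q : Matrix ι ι ℝ} (hQ : ∀ i j, 0 ≤ Q i j) (r : ℕ) (i j : ι) : 0 ≤ (Q ^ r) i j := by
  induction r generalizing i j with
  | zero =>
    rw [pow_zero, Matrix.one_apply]
    split_ifs <;> norm_num
  | succ k ih =>
    rw [pow_succ, Matrix.mul_apply]
    exact Finset.sum_nonneg fun l _ => mul_nonneg (ih i l) (hQ l j)

/-- A vector fixed by a matrix is fixed by all its powers. -/
theorem Matrix.pow_mulVec_eq_self {ι : Type*} [Fintype ι] [DecidableEq ι]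
    {Q : Matrix ι ι ℝ} {v : ι → ℝ} (hv : Q.mulVec v = v) (r : ℕ) : (Q ^ r).mulVec v = v := by
  induction r with
  | zero => simp
  | succ k ih => rw [pow_succ, ← Matrix.mulVec_mulVec, hv, ih]

/-- If `Q` is entrywise nonnegative with all row sums at most 1, and for every index `i`
some power `Q^r` (with `r ≥ 1`) has `i`-th row sum strictly less than 1, then `I - Q` is
invertible. -/
theorem substochastic_one_sub_isUnit (n : ℕ) (Q : Matrix (Fin n) (Fin n) ℝ)
    (hnn : ∀ i j, 0 ≤ Q i j) (hrow : ∀ i, ∑ j, Q i j ≤ 1)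
    (h : ∀ i : Fin n, ∃ r : ℕ, 1 ≤ r ∧ ∑ j, (Q ^ r) i j < 1) :
    IsUnit (1 - Q) := by
  rw [Matrix.isUnit_iff_isUnit_det, isUnit_iff_ne_zero]
  intro hdet
  obtain ⟨v, hv0, hv⟩ := Matrix.exists_mulVec_eq_zero_iff.mpr hdet
  have hfix : Q.mulVec v = v := by
    rw [Matrix.sub_mulVec, Matrix.one_mulVec, sub_eq_zero] at hv
    exact hv.symm
  obtain ⟨k, hk⟩ := Function.ne_iff.mp hv0
  obtain ⟨i, -, hi⟩ :=
    Finset.exists_max_image Finset.univ (fun j => |v j|) ⟨k, Finset.mem_univ k⟩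
  have hpos : 0 < |v i| := (abs_pos.mpr hk).trans_le (hi k (Finset.mem_univ k))
  obtain ⟨r, -, hr⟩ := h i
  have hle : |v i| ≤ (∑ j, (Q ^ r) i j) * |v i| := by
    calc |v i| = |∑ j, (Q ^ r) i j * v j| :=
          congrArg abs (congrFun (Matrix.pow_mulVec_eq_self hfix r) i).symm
      _ ≤ ∑ j, |(Q ^ r) i j * v j| := Finset.abs_sum_le_sum_abs _ _
      _ ≤ ∑ j, (Q ^ r) i j * |v i| := Finset.sum_le_sum fun j hj => by
          have hQ := Matrix.pow_apply_nonneg_of_nonneg_s5 hnn r i j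
          rw [abs_mul, abs_of_nonneg hQ]
          exact mul_le_mul_of_nonneg_left (hi j hj) hQ
      _ = (∑ j, (Q ^ r) i j) * |v i| := (Finset.sum_mul _ _ _).symm
  exact absurd hle (not_le.mpr (mul_lt_of_lt_one_left hpos hr))
end

section
/- Let G be a finite connected simple graph with nonempty seed set {x_1, …, x_s} (s ≥ 1) and non-seed nodes u_1, …, u_{n−s} with n − s ≥ 1, let A_1 be the adjacency matrix of the induced subgraph on the non-seed nodes, and let D_1 be the diagonal matrix with D_1(i,i) = deg_G(u_i), degrees taken in the full graph G. Then the matrix D_1 − A_1 is invertible. -/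
/-- Extending a vector by zero does not see more of a block matrix than its upper left block. -/
theorem Matrix.toLinearMap₂'_sumElim_zero {R m n : Type*} [CommRing R] [Fintype m] [Fintype n]
    [DecidableEq m] [DecidableEq n] (M : Matrix (m ⊕ n) (m ⊕ n) R) (v : m → R) :
    Matrix.toLinearMap₂' R M (Sum.elim v 0) (Sum.elim v 0) =
      dotProduct v (M.toBlocks₁₁.mulVec v) := by
  simp [Matrix.toLinearMap₂'_apply', dotProduct, Matrix.mulVec, Matrix.toBlocks₁₁]

/-- A principal block of the Laplacian of a connected graph that leaves out at least one vertex
is invertible. -/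
theorem SimpleGraph.Connected.isUnit_toBlocks₁₁_lapMatrix {V W : Type*} [Fintype V] [Fintype W]
    [DecidableEq V] [DecidableEq W] [Nonempty W] {G : SimpleGraph (V ⊕ W)} [DecidableRel G.Adj]
    (hG : G.Connected) : IsUnit (G.lapMatrix ℝ).toBlocks₁₁ := by
  rw [Matrix.isUnit_iff_isUnit_det, isUnit_iff_ne_zero]
  intro hdet
  obtain ⟨v, hv, hLv⟩ := Matrix.exists_mulVec_eq_zero_iff.mpr hdet
  have hzero := Matrix.toLinearMap₂'_sumElim_zero (G.lapMatrix ℝ) v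
  rw [hLv, dotProduct_zero, G.lapMatrix_toLinearMap₂'_apply'_eq_zero_iff_forall_reachable] at hzero
  obtain ⟨w⟩ := ‹Nonempty W›
  exact hv (funext fun i => hzero (Sum.inl i) (Sum.inr w) (hG.preconnected _ _))

/-- Let `G` be a finite connected simple graph whose vertices split into non-seed nodes
`Sum.inl i` (at least one) and seed nodes `Sum.inr j` (at least one). With `A₁` the
adjacency matrix of the subgraph induced on the non-seed nodes and `D₁` the diagonal
matrix of the degrees (in the full graph `G`) of the non-seed nodes, the matrix
`D₁ - A₁` is invertible. -/
theorem laplacian_block_invertible (ns s : ℕ) (hns : 1 ≤ ns) (hs : 1 ≤ s)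
    (G : SimpleGraph (Fin ns ⊕ Fin s)) [DecidableRel G.Adj] (hG : G.Connected)
    (A1 : Matrix (Fin ns) (Fin ns) ℝ)
    (hA1 : ∀ i j, A1 i j = if G.Adj (Sum.inl i) (Sum.inl j) then 1 else 0)
    (D1 : Matrix (Fin ns) (Fin ns) ℝ)
    (hD1 : D1 = Matrix.diagonal (fun i => (G.degree (Sum.inl i) : ℝ))) :
    IsUnit (D1 - A1) := by
  have : Nonempty (Fin s) := ⟨⟨0, hs⟩⟩
  convert hG.isUnit_toBlocks₁₁_lapMatrix using 1
  ext i j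
  simp [hD1, hA1, Matrix.toBlocks₁₁, SimpleGraph.lapMatrix, SimpleGraph.degMatrix,
    Matrix.diagonal_apply]
end
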